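/- arXiv:1707.04699 — 6 statements merged into one kernel-verified Lean document; each statement's English description precedes it below -/
import Mathlib

section
/- Let λ > 0, r > 0, d > 0, let β : ℝ → ℝ be bounded and continuous, let c₁ ∈ ℝ and l̄ ∈ ℝ, and set j(z) = z + ln(d/(λ+d)). Define V_G : (−∞, l̄] → ℝ by V_G(l) = exp(−(r+d)(l̄−l)/λ)·β(l̄)/r + ∫_l^{l̄} [ (β(z) − c₁)/λ + d·β(j(z))/(rλ) ] · exp(−(r+d)(z−l)/λ) dz. Then V_G is continuous on (−∞, l̄] with V_G(l̄) = β(l̄)/r, V_G is differentiable on (−∞, l̄), and for every l < l̄ it satisfies r·V_G(l) = β(l) − c₁ + λ·V_G′(l) + d·( β(j(l))/r − V_G(l) ). -/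
open MeasureTheory

/-- Variation of constants: the discounted payoff with rate `a`, terminal value `B` at `b` and
continuous flow `g` solves the linear equation `V' = a V - g`. -/
theorem hasDerivAt_discounted_integral {g : ℝ → ℝ} (hg : Continuous g) (a b B l : ℝ) :
    HasDerivAt
      (fun l => Real.exp (-(a * (b - l))) * B + ∫ z in l..b, g z * Real.exp (-(a * (z - l))))
      (a * (Real.exp (-(a * (b - l))) * B + ∫ z in l..b, g z * Real.exp (-(a * (z - l)))) - g l)
      l := by
  have factor : ∀ x, Real.exp (-(a * (b - x))) * B +
      (∫ z in x..b, g z * Real.exp (-(a * (z - x)))) =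
      Real.exp (a * x) *
        (Real.exp (-(a * b)) * B + ∫ z in x..b, g z * Real.exp (-(a * z))) := by
    intro x
    rw [mul_add, ← mul_assoc, ← Real.exp_add, ← intervalIntegral.integral_const_mul]
    congr 1
    · ring_nf
    · refine intervalIntegral.integral_congr fun z _ => ?_
      rw [mul_left_comm, ← Real.exp_add]
      ring_nf
  simp only [factor]
  have hcont : Continuous fun z => g z * Real.exp (-(a * z)) := by fun_prop
  have hint := intervalIntegral.integral_hasDerivAt_left (hcont.intervalIntegrable l b)
    (hcont.stronglyMeasurableAtFilter _ _) hcont.continuousAt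
  have hexp : HasDerivAt (fun x => Real.exp (a * x)) (Real.exp (a * l) * a) l := by
    simpa using ((hasDerivAt_id l).const_mul a).exp
  have hone : Real.exp (a * l) * Real.exp (-(a * l)) = 1 := by
    rw [← Real.exp_add, add_neg_cancel, Real.exp_zero]
  refine (hexp.mul (hint.const_add (Real.exp (-(a * b)) * B))).congr_deriv ?_
  linear_combination -g l * hone

/-- Closed-form solution (8) of the good type's HJB equation in the scrutiny region
with minimal signal rate `d > 0` and finite upper endpoint `l̄`: the function `V_G`
defined by the explicit formula is continuous on `(-∞, l̄]`, satisfies the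
value-matching condition `V_G(l̄) = β(l̄)/r`, is differentiable on `(-∞, l̄)`, and
solves `r V_G(l) = β(l) - c₁ + λ V_G'(l) + d (β(j(l))/r - V_G(l))` there. -/
theorem stmt_1
    (lam r d c₁ lb : ℝ) (hlam : 0 < lam) (hr : 0 < r) (hd : 0 < d)
    (β : ℝ → ℝ) (hβb : ∃ M, ∀ x, |β x| ≤ M) (hβc : Continuous β)
    (j : ℝ → ℝ) (hj : ∀ z, j z = z + Real.log (d / (lam + d)))
    (VG : ℝ → ℝ)
    (hVG : ∀ l, VG l =
      Real.exp (-((r + d) * (lb - l) / lam)) * (β lb / r) +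
      ∫ z in l..lb, ((β z - c₁) / lam + d * β (j z) / (r * lam)) *
        Real.exp (-((r + d) * (z - l) / lam))) :
    ContinuousOn VG (Set.Iic lb) ∧
    VG lb = β lb / r ∧
    (∀ l < lb, DifferentiableAt ℝ VG l) ∧
    (∀ l < lb, r * VG l = β l - c₁ + lam * deriv VG l + d * (β (j l) / r - VG l)) := by
  have hjc : Continuous j := by
    rw [funext hj]
    fun_prop
  have hderiv : ∀ l, HasDerivAt VG
      ((r + d) / lam * VG l - ((β l - c₁) / lam + d * β (j l) / (r * lam))) l := by
    intro l
    have h := hasDerivAt_discounted_integral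
      (g := fun z => (β z - c₁) / lam + d * β (j z) / (r * lam)) (by fun_prop)
      ((r + d) / lam) lb (β lb / r) l
    simp only [div_mul_eq_mul_div (r + d) lam, ← hVG] at h
    rwa [← div_mul_eq_mul_div] at h
  refine ⟨fun l _ => (hderiv l).continuousAt.continuousWithinAt, by simp [hVG],
    fun l _ => (hderiv l).differentiableAt, fun l _ => ?_⟩
  rw [(hderiv l).deriv]
  field_simp
  ring
end

section
/- Let λ > 0, r > 0, let β : ℝ → ℝ be bounded and continuous, and set β_min = inf β. Then for every l ∈ ℝ the improper integral V_B(l) = ∫_l^∞ ( β(z)/λ + β_min/r ) · exp(−(r+λ)(z−l)/λ) dz converges; the function V_B so defined is differentiable on ℝ and satisfies r·V_B(l) = β(l) + λ·V_B′(l) + λ·( β_min/r − V_B(l) ) for all l ∈ ℝ. -/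
open MeasureTheory

theorem integrableOn_Ioi_mul_exp_neg {g : ℝ → ℝ} {c M : ℝ} (hc : 0 < c) (hg : Continuous g)
    (hM : ∀ x, |g x| ≤ M) (l : ℝ) :
    IntegrableOn (fun z => g z * Real.exp (-c * z)) (Set.Ioi l) :=
  (exp_neg_integrableOn_Ioi l hc).bdd_mul hg.aestronglyMeasurable
    (Filter.Eventually.of_forall hM)

theorem hasDerivAt_integral_Ioi {f : ℝ → ℝ} (hf : Continuous f)
    (hint : ∀ l, IntegrableOn f (Set.Ioi l)) (l : ℝ) :
    HasDerivAt (fun a => ∫ z in Set.Ioi a, f z) (-f l) l := by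
  have h : (fun a => ∫ z in Set.Ioi a, f z) =
      fun a => (∫ z in Set.Ioi 0, f z) - ∫ z in (0 : ℝ)..a, f z := by
    funext a
    rw [← intervalIntegral.integral_interval_add_Ioi (hint 0) (hint a)]
    ring
  rw [h]
  exact (hf.integral_hasStrictDerivAt 0 l).hasDerivAt.const_sub _

/-- The `d = 0`, `l̄ = ∞` case of the closed form (8) for the bad type: with
`β_min = inf β`, the improper integral
`V_B(l) = ∫_l^∞ (β(z)/λ + β_min/r) exp(-(r+λ)(z-l)/λ) dz` converges for every `l`,
and the resulting function is differentiable and satisfies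
`r V_B(l) = β(l) + λ V_B'(l) + λ (β_min/r - V_B(l))` everywhere. -/
theorem stmt_4
    (lam r : ℝ) (hlam : 0 < lam) (hr : 0 < r)
    (β : ℝ → ℝ) (hβb : ∃ M, ∀ x, |β x| ≤ M) (hβc : Continuous β)
    (βmin : ℝ) (hβmin : βmin = sInf (Set.range β))
    (VB : ℝ → ℝ)
    (hVB : ∀ l, VB l =
      ∫ z in Set.Ioi l, (β z / lam + βmin / r) * Real.exp (-((r + lam) * (z - l) / lam))) :
    (∀ l : ℝ, IntegrableOn
      (fun z => (β z / lam + βmin / r) * Real.exp (-((r + lam) * (z - l) / lam)))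
      (Set.Ioi l)) ∧
    (∀ l, DifferentiableAt ℝ VB l) ∧
    (∀ l, r * VB l = β l + lam * deriv VB l + lam * (βmin / r - VB l)) := by
  obtain ⟨M, hM⟩ := hβb
  have hc : 0 < (r + lam) / lam := by positivity
  set c := (r + lam) / lam with hc_def
  set g : ℝ → ℝ := fun z => β z / lam + βmin / r with hg_def
  have hg : Continuous g := by fun_prop
  have hgb : ∀ x, |g x| ≤ M / lam + |βmin / r| := fun x => by
    refine (abs_add_le _ _).trans ?_
    rw [abs_div, abs_of_pos hlam]
    gcongr
    exact hM x
  have hint := integrableOn_Ioi_mul_exp_neg hc hg hgb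
  have hsplit : ∀ l z, (β z / lam + βmin / r) * Real.exp (-((r + lam) * (z - l) / lam)) =
      Real.exp (c * l) * (g z * Real.exp (-c * z)) := fun l z => by
    have h : -((r + lam) * (z - l) / lam) = c * l + -c * z := by
      rw [hc_def]
      ring
    rw [h, Real.exp_add]
    ring
  have hV : VB = fun l => Real.exp (c * l) * ∫ z in Set.Ioi l, g z * Real.exp (-c * z) := by
    funext l
    simp_rw [hVB l, hsplit l]
    exact integral_const_mul _ _
  have hderiv : ∀ l, HasDerivAt VB (c * VB l - g l) l := fun l => by
    have hexp : HasDerivAt (fun x => Real.exp (c * x)) (Real.exp (c * l) * (c * 1)) l :=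
      ((hasDerivAt_id l).const_mul c).exp
    have h := hexp.mul (hasDerivAt_integral_Ioi (by fun_prop) hint l)
    rw [hV]
    refine h.congr_deriv ?_
    have hinv : Real.exp (c * l) * Real.exp (-c * l) = 1 := by
      rw [← Real.exp_add]
      simp
    linear_combination (-g l) * hinv
  refine ⟨fun l => ?_, fun l => (hderiv l).differentiableAt, fun l => ?_⟩
  · simp_rw [hsplit l]
    exact (hint l).const_mul _
  · rw [(hderiv l).deriv, hc_def, hg_def]
    field_simp
    ring
end

section
/- Let λ > 0, d > 0, c > 0, and let B_min ≤ B_max be real numbers. Set s = ln((λ+d)/d) > 0. Let V : ℝ → ℝ satisfy B_min ≤ V(x) ≤ B_max for all x ∈ ℝ. If l₁ < l̄ are real numbers such that V(l) − V(l − s) ≥ c/λ for every l ∈ (l₁, l̄), then l̄ − l₁ ≤ ( λ(B_max − B_min)/c + 1 ) · s. -/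
/-- If `V` drops by at least `δ` across each of `n` consecutive downward steps of length `s`
started at `x`, then it drops by at least `n * δ` in total. -/
theorem nat_mul_le_sub_of_forall_step {V : ℝ → ℝ} {x s δ : ℝ} (n : ℕ)
    (h : ∀ k < n, δ ≤ V (x - k * s) - V (x - k * s - s)) :
    n * δ ≤ V x - V (x - n * s) := by
  induction n with
  | zero => simp
  | succ n ih =>
    have h₁ := ih fun k hk => h k (hk.trans n.lt_succ_self)
    have h₂ := h n n.lt_succ_self
    have h₃ : x - ((n + 1 : ℕ) : ℝ) * s = x - n * s - s := by push_cast; ring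
    rw [h₃]
    push_cast
    linarith


/-- Core of Lemma 2: if a function `V` bounded between `B_min` and `B_max` drops by at
least `c/λ` across every downward jump of length `s = ln((λ+d)/d)` started in the
interval `(l₁, l̄)`, then the interval has length at most
`(λ(B_max - B_min)/c + 1) · s`. -/
theorem stmt_9
    (lam d c Bmin Bmax : ℝ) (hlam : 0 < lam) (hd : 0 < d) (hc : 0 < c)
    (hBB : Bmin ≤ Bmax)
    (s : ℝ) (hs : s = Real.log ((lam + d) / d))
    (V : ℝ → ℝ) (hV : ∀ x, Bmin ≤ V x ∧ V x ≤ Bmax)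
    (l₁ lb : ℝ) (hllb : l₁ < lb)
    (hjump : ∀ l ∈ Set.Ioo l₁ lb, V l - V (l - s) ≥ c / lam) :
    lb - l₁ ≤ (lam * (Bmax - Bmin) / c + 1) * s := by
  have hs_pos : 0 < s := by
    rw [hs]
    exact Real.log_pos ((one_lt_div hd).2 (by linarith))
  by_contra! hlong
  set K := lam * (Bmax - Bmin) / c with hK
  have hK_nonneg : 0 ≤ K := div_nonneg (mul_nonneg hlam.le (sub_nonneg.2 hBB)) hc.le
  have hdrop : ((⌊K⌋₊ + 1 : ℕ) : ℝ) * (c / lam) ≤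
      V (lb - s / 2) - V (lb - s / 2 - ((⌊K⌋₊ + 1 : ℕ) : ℝ) * s) := by
    refine nat_mul_le_sub_of_forall_step _ fun k hk => hjump _ ⟨?_, ?_⟩
    · have hkK : (k : ℝ) ≤ K :=
        (Nat.cast_le.2 (Nat.lt_succ_iff.1 hk)).trans (Nat.floor_le hK_nonneg)
      have := mul_le_mul_of_nonneg_right hkK hs_pos.le
      linarith
    · have : 0 ≤ (k : ℝ) * s := by positivity
      linarith
  have hfloor : K < ((⌊K⌋₊ + 1 : ℕ) : ℝ) := by
    push_cast
    exact Nat.lt_floor_add_one K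
  have hlt := mul_lt_mul_of_pos_right hfloor (div_pos hc hlam)
  have hKc : K * (c / lam) = Bmax - Bmin := by
    rw [hK]
    field_simp
  linarith [(hV (lb - s / 2)).2, (hV (lb - s / 2 - ((⌊K⌋₊ + 1 : ℕ) : ℝ) * s)).1]
end

section
/- Let λ > 0, r > 0, let β : ℝ → ℝ be bounded, continuous and nondecreasing, and set β_min = inf β, β_max = sup β, W(l) = ∫_l^∞ ( β(z)/λ + β_min/r ) · exp(−(r+λ)(z−l)/λ) dz, and W_∞ = β_max/(r+λ) + λ·β_min/(r(r+λ)). Let c′ : [0,1] → ℝ be continuous, let l < l₁ be real numbers, let K ∈ ℝ, and set ê = 1 − exp(l − l₁) ∈ (0,1). If λ·(K − W(l₁)) ≥ c′(ê) and λ·(K − W_∞) < c′(1), then there exists e* ∈ [ê, 1) such that λ·( K − W( l + ln(1/(1 − e*)) ) ) = c′(e*). -/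
open MeasureTheory

open Filter Topology Set

theorem integral_Ioi_discounted_eq_shift (f : ℝ → ℝ) (a l : ℝ) :
    ∫ z in Ioi l, f z * Real.exp (-(a * (z - l))) =
      ∫ t in Ioi (0 : ℝ), f (t + l) * Real.exp (-(a * t)) := by
  have h := (measurePreserving_add_right volume l).setIntegral_preimage_emb
    (measurableEmbedding_addRight l) (fun z => f z * Real.exp (-(a * (z - l)))) (Ioi l)
  rw [← h]
  simp

theorem integrableOn_const_mul_exp_neg_mul_Ioi {a : ℝ} (ha : 0 < a) (C : ℝ) :
    IntegrableOn (fun t => C * Real.exp (-(a * t))) (Ioi 0) := by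
  simpa only [IntegrableOn, neg_mul] using (exp_neg_integrableOn_Ioi 0 ha).const_mul C

theorem norm_mul_exp_neg_le {C x : ℝ} (hx : |x| ≤ C) (y : ℝ) :
    ‖x * Real.exp (-y)‖ ≤ C * Real.exp (-y) := by
  rw [norm_mul, Real.norm_eq_abs, Real.norm_eq_abs, Real.abs_exp]
  gcongr

theorem continuous_integral_Ioi_discounted {f : ℝ → ℝ} {C a : ℝ} (ha : 0 < a)
    (hf : Continuous f) (hC : ∀ x, |f x| ≤ C) :
    Continuous fun l => ∫ z in Ioi l, f z * Real.exp (-(a * (z - l))) := by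
  simp only [integral_Ioi_discounted_eq_shift]
  refine continuous_of_dominated (bound := fun t => C * Real.exp (-(a * t))) (fun l => ?_)
    (fun l => ?_) (integrableOn_const_mul_exp_neg_mul_Ioi ha C) ?_
  · exact Continuous.aestronglyMeasurable (by fun_prop)
  · exact Eventually.of_forall fun t => norm_mul_exp_neg_le (hC _) _
  · exact Eventually.of_forall fun t => by fun_prop

theorem tendsto_integral_Ioi_discounted {f : ℝ → ℝ} {C a L : ℝ} (ha : 0 < a)
    (hf : Continuous f) (hC : ∀ x, |f x| ≤ C) (hL : Tendsto f atTop (𝓝 L)) :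
    Tendsto (fun l => ∫ z in Ioi l, f z * Real.exp (-(a * (z - l)))) atTop (𝓝 (L / a)) := by
  have hint : ∫ t in Ioi (0 : ℝ), L * Real.exp (-(a * t)) = L / a := by
    have h := integral_exp_mul_Ioi (neg_lt_zero.mpr ha) 0
    simp only [neg_mul, mul_zero, Real.exp_zero] at h
    rw [integral_const_mul, h]
    field_simp
  simp only [integral_Ioi_discounted_eq_shift]
  rw [← hint]
  refine tendsto_integral_filter_of_dominated_convergence (fun t => C * Real.exp (-(a * t)))
    (Eventually.of_forall fun l => ?_) (Eventually.of_forall fun l => ?_)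
    (integrableOn_const_mul_exp_neg_mul_Ioi ha C) (Eventually.of_forall fun t => ?_)
  · exact Continuous.aestronglyMeasurable (by fun_prop)
  · exact Eventually.of_forall fun t => norm_mul_exp_neg_le (hC _) _
  · exact (hL.comp (tendsto_atTop_add_const_left _ t tendsto_id)).mul_const _

/-- Intermediate Value Theorem step establishing the existence of the interior
equilibrium effort of the bad type in the early-career region (Propositions 2 and 3):
with `W` the bad type's scrutiny-region value function (the `d = 0` case of (8)) and
`W_∞` its limit at `∞`, if `λ(K - W(l₁)) ≥ c'(ê)` and `λ(K - W_∞) < c'(1)`, where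
`ê = 1 - exp(l - l₁)`, then some `e* ∈ [ê, 1)` solves
`λ(K - W(l + ln(1/(1-e*)))) = c'(e*)`. -/
theorem stmt_10
    (lam r : ℝ) (hlam : 0 < lam) (hr : 0 < r)
    (β : ℝ → ℝ) (hβb : ∃ M, ∀ x, |β x| ≤ M) (hβc : Continuous β) (hβm : Monotone β)
    (βmin βmax : ℝ) (hβmin : βmin = sInf (Set.range β)) (hβmax : βmax = sSup (Set.range β))
    (W : ℝ → ℝ)
    (hW : ∀ l, W l =
      ∫ z in Set.Ioi l, (β z / lam + βmin / r) * Real.exp (-((r + lam) * (z - l) / lam)))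
    (Winf : ℝ) (hWinf : Winf = βmax / (r + lam) + lam * βmin / (r * (r + lam)))
    (c' : ℝ → ℝ) (hc' : ContinuousOn c' (Set.Icc 0 1))
    (l l₁ K : ℝ) (hll : l < l₁)
    (ehat : ℝ) (hehat : ehat = 1 - Real.exp (l - l₁))
    (h1 : lam * (K - W l₁) ≥ c' ehat)
    (h2 : lam * (K - Winf) < c' 1) :
    ∃ estar ∈ Set.Ico ehat 1,
      lam * (K - W (l + Real.log (1 / (1 - estar)))) = c' estar := by
  obtain ⟨M, hM⟩ := hβb
  have ha : 0 < (r + lam) / lam := by positivity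
  have hWeq : W = fun l => ∫ z in Ioi l,
      (β z / lam + βmin / r) * Real.exp (-((r + lam) / lam * (z - l))) := by
    funext l
    simp only [hW, div_mul_eq_mul_div]
  have hfc : Continuous fun z => β z / lam + βmin / r := by fun_prop
  have hfb : ∀ z, |β z / lam + βmin / r| ≤ M / lam + |βmin / r| := fun z => by
    refine (abs_add_le _ _).trans ?_
    rw [abs_div, abs_of_pos hlam]
    gcongr
    exact hM z
  have hbdd : BddAbove (range β) := ⟨M, by rintro _ ⟨x, rfl⟩; exact (abs_le.mp (hM x)).2⟩
  have hβlim : Tendsto β atTop (𝓝 βmax) := hβmax ▸ tendsto_atTop_ciSup hβm hbdd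
  have hWc : Continuous W := hWeq ▸ continuous_integral_Ioi_discounted ha hfc hfb
  have hWlim : Tendsto W atTop (𝓝 Winf) := by
    have h := tendsto_integral_Ioi_discounted ha hfc hfb
      ((hβlim.div_const lam).add_const (βmin / r))
    rw [← hWeq] at h
    convert h using 2
    rw [hWinf]
    field_simp
  have heffort : ∀ x ∈ Ici l₁, 1 - Real.exp (l - x) ∈ Icc (0 : ℝ) 1 := fun x hx => by
    have hx' : l₁ ≤ x := hx
    have h := Real.exp_le_one_iff.mpr (by linarith : l - x ≤ 0)
    exact ⟨by linarith, by linarith [Real.exp_pos (l - x)]⟩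
  have hclim : Tendsto (fun x => c' (1 - Real.exp (l - x))) atTop (𝓝 (c' 1)) := by
    refine (hc' 1 (right_mem_Icc.mpr zero_le_one)).tendsto.comp
      (tendsto_nhdsWithin_iff.mpr ⟨?_, (eventually_ge_atTop l₁).mono heffort⟩)
    have h := Real.tendsto_exp_atBot.comp
      (tendsto_atBot_add_const_left atTop l tendsto_neg_atTop_atBot)
    simpa [Function.comp_def, sub_eq_add_neg] using h.const_sub 1
  obtain ⟨b, hb, hlb⟩ := (((((hWlim.const_sub K).const_mul lam).eventually_lt hclim h2)).and
    (eventually_ge_atTop l₁)).exists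
  have hcc : ContinuousOn (fun x => c' (1 - Real.exp (l - x))) (Icc l₁ b) :=
    hc'.comp (by fun_prop) fun x hx => heffort x hx.1
  obtain ⟨x, hx, hxeq⟩ := isPreconnected_Icc.intermediate_value₂
    (right_mem_Icc.mpr hlb) (left_mem_Icc.mpr hlb)
    (f := fun x => lam * (K - W x)) (by fun_prop) hcc hb.le (by simpa [hehat] using h1)
  refine ⟨1 - Real.exp (l - x), ⟨?_, by linarith [Real.exp_pos (l - x)]⟩, ?_⟩
  · rw [hehat]
    gcongr
    exact hx.1
  · have hlog : l + Real.log (1 / (1 - (1 - Real.exp (l - x)))) = x := by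
      rw [sub_sub_cancel, one_div, Real.log_inv, Real.log_exp]
      ring
    rw [hlog]
    exact hxeq
end

section
/- Let λ > 0, r > 0, let d_G > 0 and d_B > 0 satisfy a := λ − d_G + d_B > 0, let β : ℝ → ℝ be bounded and continuous, let l̄ ∈ ℝ, and set j(z) = z + ln( d_G/(λ + d_B) ). Define V_B : (−∞, l̄] → ℝ by V_B(l) = exp(−(r+λ+d_B)(l̄−l)/a)·β(l̄)/r + ∫_l^{l̄} ( ( β(z) + (λ+d_B)·β(j(z))/r ) / a ) · exp(−(r+λ+d_B)(z−l)/a) dz. Then V_B is differentiable on (−∞, l̄), satisfies r·V_B(l) = β(l) + a·V_B′(l) + (λ+d_B)·( β(j(l))/r − V_B(l) ) for every l < l̄, and V_B(l̄) = β(l̄)/r. -/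
open MeasureTheory

/-- The exponentially discounted sum of a terminal value `C` at `b` and a continuous flow `g`
solves the linear equation `V' = k V - g`. -/
theorem hasDerivAt_exp_mul_add_integral_discounted {g : ℝ → ℝ} (hg : Continuous g)
    (k b C x : ℝ) :
    HasDerivAt
      (fun l => Real.exp (-(k * (b - l))) * C + ∫ z in l..b, g z * Real.exp (-(k * (z - l))))
      (k * (Real.exp (-(k * (b - x))) * C + ∫ z in x..b, g z * Real.exp (-(k * (z - x)))) - g x)
      x := by
  have hfactor : ∀ l, Real.exp (-(k * (b - l))) * C +
      ∫ z in l..b, g z * Real.exp (-(k * (z - l))) =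
      Real.exp (k * l) * (Real.exp (-(k * b)) * C + ∫ z in l..b, g z * Real.exp (-(k * z))) := by
    intro l
    have hexp : ∀ z, Real.exp (-(k * (z - l))) = Real.exp (k * l) * Real.exp (-(k * z)) := by
      intro z
      rw [← Real.exp_add]
      ring_nf
    simp only [hexp, mul_add, mul_left_comm (g _), intervalIntegral.integral_const_mul, mul_assoc]
  have hcont : Continuous fun z => g z * Real.exp (-(k * z)) := by fun_prop
  have hint := intervalIntegral.integral_hasDerivAt_left (hcont.intervalIntegrable x b)
    (hcont.stronglyMeasurableAtFilter _ _) hcont.continuousAt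
  have hexp : HasDerivAt (fun l => Real.exp (k * l)) (Real.exp (k * x) * k) x := by
    simpa using ((hasDerivAt_id x).const_mul k).exp
  simp only [hfactor]
  refine (hexp.mul (hint.const_add (Real.exp (-(k * b)) * C))).congr_deriv ?_
  have hcancel : Real.exp (k * x) * Real.exp (-(k * x)) = 1 := by
    rw [← Real.exp_add, add_neg_cancel, Real.exp_zero]
  linear_combination -g x * hcancel

/-- Closed-form solution (13) of the bad type's HJB equation in the scrutiny region
with type-dependent minimal signal rates `d_G, d_B > 0` and drift `a = λ - d_G + d_B`:
the function `V_B` defined by the explicit formula is differentiable on `(-∞, l̄)`,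
solves `r V_B(l) = β(l) + a V_B'(l) + (λ+d_B)(β(j(l))/r - V_B(l))` there, and
satisfies the value-matching condition `V_B(l̄) = β(l̄)/r`. -/
theorem stmt_14
    (lam r dG dB lb : ℝ) (hlam : 0 < lam) (hr : 0 < r) (hdG : 0 < dG) (hdB : 0 < dB)
    (a : ℝ) (ha : a = lam - dG + dB) (hapos : 0 < a)
    (β : ℝ → ℝ) (hβb : ∃ M, ∀ x, |β x| ≤ M) (hβc : Continuous β)
    (j : ℝ → ℝ) (hj : ∀ z, j z = z + Real.log (dG / (lam + dB)))
    (VB : ℝ → ℝ)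
    (hVB : ∀ l, VB l =
      Real.exp (-((r + lam + dB) * (lb - l) / a)) * (β lb / r) +
      ∫ z in l..lb, ((β z + (lam + dB) * β (j z) / r) / a) *
        Real.exp (-((r + lam + dB) * (z - l) / a))) :
    (∀ l < lb, DifferentiableAt ℝ VB l) ∧
    (∀ l < lb,
      r * VB l = β l + a * deriv VB l + (lam + dB) * (β (j l) / r - VB l)) ∧
    VB lb = β lb / r := by
  have hj_cont : Continuous j := by
    rw [funext hj]
    fun_prop
  have hg : Continuous fun z => (β z + (lam + dB) * β (j z) / r) / a := by fun_prop
  have hderiv : ∀ l, HasDerivAt VB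
      ((r + lam + dB) / a * VB l - (β l + (lam + dB) * β (j l) / r) / a) l := by
    intro l
    have h := hasDerivAt_exp_mul_add_integral_discounted hg ((r + lam + dB) / a) lb (β lb / r) l
    have hrate : ∀ y, (r + lam + dB) / a * y = (r + lam + dB) * y / a :=
      fun y => div_mul_eq_mul_div _ _ _
    simp only [hrate] at h ⊢
    simp only [← hVB] at h
    exact h
  refine ⟨fun l _ => (hderiv l).differentiableAt, fun l _ => ?_, ?_⟩
  · rw [(hderiv l).deriv]
    field_simp
    ring
  · simp [hVB lb]
end

section
/- Let λ > 0, r > 0, let d_G > 0 and d_B > 0 satisfy a := λ − d_G + d_B > 0, let β : ℝ → ℝ be bounded and continuous, let c₁ ∈ ℝ, let l̄ ∈ ℝ, and set j(z) = z + ln( d_G/(λ + d_B) ). Define V_G : (−∞, l̄] → ℝ by V_G(l) = exp(−(r+d_G)(l̄−l)/a)·β(l̄)/r + ∫_l^{l̄} ( ( β(z) − c₁ + d_G·β(j(z))/r ) / a ) · exp(−(r+d_G)(z−l)/a) dz. Then V_G is differentiable on (−∞, l̄), satisfies r·V_G(l) = β(l) − c₁ + a·V_G′(l) + d_G·( β(j(l))/r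 − V_G(l) ) for every l < l̄, and V_G(l̄) = β(l̄)/r. -/
open MeasureTheory

/-- The discounted terminal value plus discounted flow `f` up to the terminal point `b`
solves the linear equation `V' = k V - f`. -/
theorem hasDerivAt_discounted_value {f : ℝ → ℝ} (hf : Continuous f) (k b C l : ℝ) :
    HasDerivAt
      (fun x => Real.exp (-(k * (b - x))) * C + ∫ z in x..b, f z * Real.exp (-(k * (z - x))))
      (k * (Real.exp (-(k * (b - l))) * C + ∫ z in l..b, f z * Real.exp (-(k * (z - l)))) - f l)
      l := by
  have factor : ∀ x,
      Real.exp (-(k * (b - x))) * C + ∫ z in x..b, f z * Real.exp (-(k * (z - x))) =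
        Real.exp (k * x) * (Real.exp (-(k * b)) * C + ∫ z in x..b, f z * Real.exp (-(k * z))) := by
    intro x
    have split : ∀ z, Real.exp (-(k * (z - x))) = Real.exp (k * x) * Real.exp (-(k * z)) := by
      intro z
      rw [← Real.exp_add]
      ring_nf
    simp_rw [split, mul_left_comm (f _), intervalIntegral.integral_const_mul]
    ring
  have hg : Continuous fun z => f z * Real.exp (-(k * z)) := by fun_prop
  have hflow : HasDerivAt (fun x => ∫ z in x..b, f z * Real.exp (-(k * z)))
      (-(f l * Real.exp (-(k * l)))) l :=
    intervalIntegral.integral_hasDerivAt_left (hg.intervalIntegrable _ _)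
      hg.aestronglyMeasurable.stronglyMeasurableAtFilter hg.continuousAt
  have hexp : HasDerivAt (fun x => Real.exp (k * x)) (Real.exp (k * l) * k) l := by
    simpa using ((hasDerivAt_id l).const_mul k).exp
  have cancel : Real.exp (k * l) * Real.exp (-(k * l)) = 1 := by
    rw [← Real.exp_add, add_neg_cancel, Real.exp_zero]
  simp_rw [factor]
  refine (hexp.mul (hflow.const_add (Real.exp (-(k * b)) * C))).congr_deriv ?_
  linear_combination -f l * cancel

/-- Closed-form solution (13) of the good type's HJB equation in the scrutiny region
with type-dependent minimal signal rates `d_G, d_B > 0` and drift `a = λ - d_G + d_B`: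
the function `V_G` defined by the explicit formula is differentiable on `(-∞, l̄)`,
solves `r V_G(l) = β(l) - c₁ + a V_G'(l) + d_G (β(j(l))/r - V_G(l))` there, and
satisfies the value-matching condition `V_G(l̄) = β(l̄)/r`. -/
theorem stmt_15
    (lam r dG dB c₁ lb : ℝ) (hlam : 0 < lam) (hr : 0 < r) (hdG : 0 < dG) (hdB : 0 < dB)
    (a : ℝ) (ha : a = lam - dG + dB) (hapos : 0 < a)
    (β : ℝ → ℝ) (hβb : ∃ M, ∀ x, |β x| ≤ M) (hβc : Continuous β)
    (j : ℝ → ℝ) (hj : ∀ z, j z = z + Real.log (dG / (lam + dB)))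
    (VG : ℝ → ℝ)
    (hVG : ∀ l, VG l =
      Real.exp (-((r + dG) * (lb - l) / a)) * (β lb / r) +
      ∫ z in l..lb, ((β z - c₁ + dG * β (j z) / r) / a) *
        Real.exp (-((r + dG) * (z - l) / a))) :
    (∀ l < lb, DifferentiableAt ℝ VG l) ∧
    (∀ l < lb,
      r * VG l = β l - c₁ + a * deriv VG l + dG * (β (j l) / r - VG l)) ∧
    VG lb = β lb / r := by
  have hjc : Continuous j := by
    rw [funext hj]
    fun_prop
  have hf : Continuous fun z => (β z - c₁ + dG * β (j z) / r) / a := by fun_prop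
  have hVG_eq : VG = fun x => Real.exp (-((r + dG) / a * (lb - x))) * (β lb / r) +
      ∫ z in x..lb, ((β z - c₁ + dG * β (j z) / r) / a) *
        Real.exp (-((r + dG) / a * (z - x))) := by
    funext x
    simp_rw [hVG x, mul_div_right_comm]
  have hderiv : ∀ l, HasDerivAt VG
      ((r + dG) / a * VG l - (β l - c₁ + dG * β (j l) / r) / a) l := by
    intro l
    rw [hVG_eq]
    exact hasDerivAt_discounted_value hf _ _ _ l
  refine ⟨fun l _ => (hderiv l).differentiableAt, fun l _ => ?_, by simp [hVG]⟩
  rw [(hderiv l).deriv]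
  field_simp
  ring
end
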